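/- arXiv:0908.3592 — 6 statements merged into one kernel-verified Lean document; each statement's English description precedes it below -/
import Mathlib

section
/- The local functions M̊^j(t,x,y) := −H(t)·y^j and N̊^j_i(t,x,y) := Σ_m γ^j_{im}(x)·y^m define a nonlinear connection on the 1-jet space, i.e. setting M̃̊^k(t̃,x̃,ỹ) := −H̃(t̃)·ỹ^k and Ñ̊^k_l(t̃,x̃,ỹ) := Σ_m γ̃^k_{lm}(x̃)·ỹ^m, one has at corresponding points (t̃ = τ(t), x̃ = φ(x), ỹ^k = Σ_j (∂φ^k/∂x^j)·(τ'(t))⁻¹·y^j) the nonlinear connection transformation rules: M̃̊^k = Σ_j M̊^j·(τ'(t))⁻²·(∂φ^k/∂x^j) − (τ'(t))⁻¹·∂ỹ^k/∂t and Ñ̊^k_l = Σ_{i,j} N̊^j_i·(τ'(t))⁻¹·(∂(φ⁻¹)^i/∂x̃^l)·(∂φ^k/∂x^j) − Σ_i (∂(φ⁻¹)^i/∂x̃^l)·(∂ỹ^k/∂x^i), where ỹ^k is viewed as the function ỹ^k(t,x,y) = Σ_j (∂φ^k/∂x^j)(x)·(τ'(t))⁻¹·y^j. -/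
noncomputable section
open scoped BigOperators

/-- The Jacobian entry `∂φ^k/∂x^j` of a map `φ : (Fin n → ℝ) → (Fin n → ℝ)`. -/
def Dmap (n : ℕ) (φ : (Fin n → ℝ) → (Fin n → ℝ)) (x : Fin n → ℝ) (k j : Fin n) : ℝ :=
  fderiv ℝ (fun z => φ z k) x (Pi.single j 1)

/-- The second derivative `∂²φ^l/∂x^q∂x^r`. -/
def D2map (n : ℕ) (φ : (Fin n → ℝ) → (Fin n → ℝ)) (x : Fin n → ℝ) (l q r : Fin n) : ℝ :=
  fderiv ℝ (fun z => fderiv ℝ (fun w => φ w l) z (Pi.single r 1)) x (Pi.single q 1)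

/-- The transformed fibre coordinate `ỹ^k`, viewed as the function
`ỹ^k(t,x,y) = Σ_j (∂φ^k/∂x^j)(x)·(τ'(t))⁻¹·y^j`. -/
def ytil (n : ℕ) (τ : ℝ → ℝ) (φ : (Fin n → ℝ) → (Fin n → ℝ)) (k : Fin n) (t : ℝ)
    (x y : Fin n → ℝ) : ℝ :=
  ∑ j, Dmap n φ x k j * (deriv τ t)⁻¹ * y j

/-- The chain rule for partial derivatives. -/
theorem fderiv_comp_single {n : ℕ} {f : (Fin n → ℝ) → ℝ} {ψ : (Fin n → ℝ) → (Fin n → ℝ)}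
    (z : Fin n → ℝ) (hf : DifferentiableAt ℝ f (ψ z)) (hψ : DifferentiableAt ℝ ψ z) (l : Fin n) :
    fderiv ℝ (fun w => f (ψ w)) z (Pi.single l 1) =
      ∑ i, fderiv ℝ f (ψ z) (Pi.single i 1) * Dmap n ψ z i l := by
  have hcomp : fderiv ℝ (fun w => f (ψ w)) z = (fderiv ℝ f (ψ z)).comp (fderiv ℝ ψ z) :=
    fderiv_comp z hf hψ
  have hcoord (i : Fin n) : fderiv ℝ ψ z (Pi.single l 1) i = Dmap n ψ z i l := by
    rw [Dmap, fderiv_apply hψ i]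
    rfl
  rw [hcomp, ContinuousLinearMap.comp_apply, pi_eq_sum_univ' (fderiv ℝ ψ z (Pi.single l 1)),
    map_sum]
  refine Finset.sum_congr rfl fun i _ => ?_
  rw [map_smul, smul_eq_mul, hcoord, mul_comm]

/-- The Jacobian matrices of mutually inverse maps are inverse to each other. -/
theorem sum_Dmap_mul_Dmap {n : ℕ} {φ ψ : (Fin n → ℝ) → (Fin n → ℝ)}
    (hφ : Differentiable ℝ φ) (hψ : Differentiable ℝ ψ) (hφψ : ∀ z, φ (ψ z) = z)
    (z : Fin n → ℝ) (k m : Fin n) :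
    ∑ s, Dmap n φ (ψ z) k s * Dmap n ψ z s m = if k = m then 1 else 0 := by
  have h := fderiv_comp_single (f := fun w => φ w k) z
    (differentiableAt_pi.1 (hφ (ψ z)) k) (hψ z) m
  simp only [hφψ] at h
  simp only [Dmap] at h ⊢
  rw [← h, (hasFDerivAt_apply k z).fderiv]
  simp [Pi.single_apply]

theorem differentiable_Dmap {n : ℕ} {φ : (Fin n → ℝ) → (Fin n → ℝ)}
    (hφ : ContDiff ℝ (⊤ : ℕ∞) φ) (k j : Fin n) :
    Differentiable ℝ (fun x => Dmap n φ x k j) := by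
  have h : ContDiff ℝ (⊤ : ℕ∞) (fun z => φ z k) := contDiff_pi.1 hφ k
  exact ((h.fderiv_right (m := 1) (by norm_cast)).clm_apply contDiff_const).differentiable
    one_ne_zero

/-- The derivative of the identity expressing that the Jacobian matrices of mutually inverse maps
are inverse to each other. -/
theorem sum_Dmap_mul_D2map {n : ℕ} {φ ψ : (Fin n → ℝ) → (Fin n → ℝ)}
    (hφ : ContDiff ℝ (⊤ : ℕ∞) φ) (hψ : ContDiff ℝ (⊤ : ℕ∞) ψ) (hφψ : ∀ z, φ (ψ z) = z)
    (z : Fin n → ℝ) (k l m : Fin n) :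
    ∑ s, Dmap n φ (ψ z) k s * D2map n ψ z s l m =
      -∑ s, (∑ i, D2map n φ (ψ z) k i s * Dmap n ψ z i l) * Dmap n ψ z s m := by
  have dφ : Differentiable ℝ φ := hφ.differentiable (by simp)
  have dψ : Differentiable ℝ ψ := hψ.differentiable (by simp)
  have hcomp (s : Fin n) : DifferentiableAt ℝ (fun w => Dmap n φ (ψ w) k s) z :=
    ((differentiable_Dmap hφ k s).comp dψ) z
  have hzero : fderiv ℝ (fun w => ∑ s, Dmap n φ (ψ w) k s * Dmap n ψ w s m) z
      (Pi.single l 1) = 0 := by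
    simp_rw [sum_Dmap_mul_Dmap dφ dψ hφψ]
    simp
  rw [fderiv_fun_sum fun s _ => (hcomp s).fun_mul (differentiable_Dmap hψ s m z),
    sum_apply] at hzero
  rw [eq_neg_iff_add_eq_zero, ← hzero, ← Finset.sum_add_distrib]
  refine Finset.sum_congr rfl fun s _ => ?_
  rw [fderiv_fun_mul (hcomp s) (differentiable_Dmap hψ s m z)]
  have h := fderiv_comp_single (f := fun x => Dmap n φ x k s) z
    (differentiable_Dmap hφ k s (ψ z)) (dψ z) l
  simp only [add_apply, smul_apply, smul_eq_mul, h]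
  rw [mul_comm (Dmap n ψ z s m)]
  rfl

theorem fderiv_ytil {n : ℕ} {τ : ℝ → ℝ} {φ : (Fin n → ℝ) → (Fin n → ℝ)}
    (hφ : ContDiff ℝ (⊤ : ℕ∞) φ) (k i : Fin n) (t : ℝ) (x y : Fin n → ℝ) :
    fderiv ℝ (fun x' => ytil n τ φ k t x' y) x (Pi.single i 1) =
      ∑ j, D2map n φ x k i j * (deriv τ t)⁻¹ * y j := by
  have hd (j : Fin n) := differentiable_Dmap hφ k j x
  simp only [ytil]
  rw [fderiv_fun_sum fun j _ => ((hd j).mul_const _).mul_const _, sum_apply]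
  refine Finset.sum_congr rfl fun j _ => ?_
  rw [fderiv_mul_const ((hd j).mul_const _), fderiv_mul_const (hd j)]
  simp only [smul_apply, smul_eq_mul, D2map, Dmap]
  ring

theorem deriv_ytil {n : ℕ} {τ : ℝ → ℝ} (φ : (Fin n → ℝ) → (Fin n → ℝ)) (k : Fin n) {t : ℝ}
    (x y : Fin n → ℝ) (hτ : DifferentiableAt ℝ (deriv τ) t) (hτ' : deriv τ t ≠ 0) :
    deriv (fun s => ytil n τ φ k s x y) t =
      -(deriv τ t)⁻¹ * deriv (deriv τ) t * ytil n τ φ k t x y := by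
  have h : HasDerivAt (fun s => ytil n τ φ k s x y)
      (∑ j, Dmap n φ x k j * (-deriv (deriv τ) t / deriv τ t ^ 2) * y j) t :=
    HasDerivAt.fun_sum fun j _ => ((hτ.hasDerivAt.fun_inv hτ').const_mul _).mul_const _
  rw [h.deriv, ytil, Finset.mul_sum]
  refine Finset.sum_congr rfl fun j _ => ?_
  field_simp

/-- Pulling back the transformed fibre coordinates along the inverse Jacobian. -/
theorem sum_Dmap_mul_ytil {n : ℕ} (τ : ℝ → ℝ) {φ ψ : (Fin n → ℝ) → (Fin n → ℝ)}
    (hφ : Differentiable ℝ φ) (hψ : Differentiable ℝ ψ) (hψφ : ∀ x, ψ (φ x) = x)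
    (t : ℝ) (x y : Fin n → ℝ) (c : Fin n) :
    ∑ m, Dmap n ψ (φ x) c m * ytil n τ φ m t x y = (deriv τ t)⁻¹ * y c := by
  simp only [ytil, Finset.mul_sum]
  rw [Finset.sum_comm]
  calc
    _ = ∑ j, (∑ m, Dmap n ψ (φ x) c m * Dmap n φ x m j) * ((deriv τ t)⁻¹ * y j) := by
      simp only [Finset.sum_mul, mul_assoc]
    _ = _ := by simp [sum_Dmap_mul_Dmap hψ hφ hψφ]

/-- The local functions `M̊^j := −H·y^j` and `N̊^j_i := Σ_m γ^j_{im}·y^m`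
define a nonlinear connection on the 1-jet space: they satisfy the nonlinear connection
transformation rules with respect to the jet coordinate change induced by
`t̃ = τ(t)`, `x̃ = φ(x)`. -/
theorem canonical_nonlinear_connection (n : ℕ)
    (τ σ : ℝ → ℝ) (φ ψ : (Fin n → ℝ) → (Fin n → ℝ))
    (hτ : ContDiff ℝ (⊤ : ℕ∞) τ) (hσ : ContDiff ℝ (⊤ : ℕ∞) σ)
    (hστ : ∀ t, σ (τ t) = t) (hτσ : ∀ s, τ (σ s) = s)
    (hφ : ContDiff ℝ (⊤ : ℕ∞) φ) (hψ : ContDiff ℝ (⊤ : ℕ∞) ψ)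
    (hψφ : ∀ x, ψ (φ x) = x) (hφψ : ∀ z, φ (ψ z) = z)
    (hτ' : ∀ t, deriv τ t ≠ 0)
    (H Htil : ℝ → ℝ) (hH : ContDiff ℝ (⊤ : ℕ∞) H) (hHtil : ContDiff ℝ (⊤ : ℕ∞) Htil)
    (hHrule : ∀ t, H t = Htil (τ t) * deriv τ t + (deriv τ t)⁻¹ * deriv (deriv τ) t)
    (γ γtil : (Fin n → ℝ) → Fin n → Fin n → Fin n → ℝ)
    (hγ : ContDiff ℝ (⊤ : ℕ∞) γ) (hγtil : ContDiff ℝ (⊤ : ℕ∞) γtil)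
    (hγrule : ∀ (x : Fin n → ℝ) (p q r : Fin n), γtil (φ x) p q r =
      (∑ i, ∑ j, ∑ k, γ x i j k * Dmap n φ x p i * Dmap n ψ (φ x) j q * Dmap n ψ (φ x) k r)
        + ∑ l, Dmap n φ x p l * D2map n ψ (φ x) l q r) :
    (∀ (t : ℝ) (x y : Fin n → ℝ) (k : Fin n),
      -(Htil (τ t)) * ytil n τ φ k t x y =
        (∑ j, (-(H t) * y j) * ((deriv τ t)⁻¹) ^ 2 * Dmap n φ x k j)
          - (deriv τ t)⁻¹ * deriv (fun s => ytil n τ φ k s x y) t) ∧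
    (∀ (t : ℝ) (x y : Fin n → ℝ) (k l : Fin n),
      (∑ m, γtil (φ x) k l m * ytil n τ φ m t x y) =
        (∑ i, ∑ j, (∑ m, γ x j i m * y m) * (deriv τ t)⁻¹ * Dmap n ψ (φ x) i l
          * Dmap n φ x k j)
          - ∑ i, Dmap n ψ (φ x) i l *
              fderiv ℝ (fun x' => ytil n τ φ k t x' y) x (Pi.single i 1)) := by
  have dφ : Differentiable ℝ φ := hφ.differentiable (by simp)
  have dψ : Differentiable ℝ ψ := hψ.differentiable (by simp)
  refine ⟨fun t x y k => ?_, fun t x y k l => ?_⟩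
  · have dτ' : Differentiable ℝ (deriv τ) :=
      ((contDiff_infty_iff_deriv.1 hτ).2).differentiable (by simp)
    have hsum : ∑ j, (-(H t) * y j) * ((deriv τ t)⁻¹) ^ 2 * Dmap n φ x k j =
        -(H t) * (deriv τ t)⁻¹ * ytil n τ φ k t x y := by
      rw [ytil, Finset.mul_sum]
      exact Finset.sum_congr rfl fun j _ => by ring
    rw [hsum, deriv_ytil φ k x y (dτ' t) (hτ' t), hHrule]
    field_simp [hτ' t]
    ring
  · have hpull := sum_Dmap_mul_ytil τ dφ dψ hψφ t x y
    have hfirst : ∑ m, (∑ i, ∑ j, ∑ c, γ x i j c * Dmap n φ x k i * Dmap n ψ (φ x) j l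
          * Dmap n ψ (φ x) c m) * ytil n τ φ m t x y =
        ∑ i, ∑ j, (∑ m, γ x j i m * y m) * (deriv τ t)⁻¹ * Dmap n ψ (φ x) i l
          * Dmap n φ x k j := by
      calc
        _ = ∑ i, ∑ j, ∑ c, γ x i j c * Dmap n φ x k i * Dmap n ψ (φ x) j l *
              ∑ m, Dmap n ψ (φ x) c m * ytil n τ φ m t x y := by
          simp only [Finset.sum_mul, Finset.mul_sum, mul_assoc]
          rw [Finset.sum_comm]
          refine Finset.sum_congr rfl fun i _ => ?_
          rw [Finset.sum_comm]
          exact Finset.sum_congr rfl fun j _ => Finset.sum_comm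
        _ = _ := by
          simp only [hpull, Finset.sum_mul]
          rw [Finset.sum_comm]
          exact Finset.sum_congr rfl fun i _ => Finset.sum_congr rfl fun j _ =>
            Finset.sum_congr rfl fun c _ => by ring
    have hsecond : ∑ m, (∑ s, Dmap n φ x k s * D2map n ψ (φ x) s l m) * ytil n τ φ m t x y =
        -∑ i, Dmap n ψ (φ x) i l *
          fderiv ℝ (fun x' => ytil n τ φ k t x' y) x (Pi.single i 1) := by
      have h (m : Fin n) := sum_Dmap_mul_D2map hφ hψ hφψ (φ x) k l m
      simp only [hψφ] at h
      simp only [h, fderiv_ytil hφ, neg_mul, Finset.sum_neg_distrib, neg_inj]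
      calc
        _ = ∑ s, (∑ i, D2map n φ x k i s * Dmap n ψ (φ x) i l) *
              ∑ m, Dmap n ψ (φ x) s m * ytil n τ φ m t x y := by
          simp only [Finset.sum_mul _ _ (ytil n τ φ _ t x y), Finset.mul_sum, mul_assoc]
          exact Finset.sum_comm
        _ = _ := by
          simp only [hpull, Finset.sum_mul, Finset.mul_sum]
          rw [Finset.sum_comm]
          exact Finset.sum_congr rfl fun i _ => Finset.sum_congr rfl fun j _ => by ring
    simp only [hγrule, add_mul, Finset.sum_add_distrib]
    rw [hfirst, hsecond, sub_eq_add_neg]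
end
end

section
/- The torsion of the Γ-linear connection ∇ satisfies, for every j: T(δ/δx^j, δ/δt) = L̄_j · δ/δt − Σ_r G^r_j · δ/δx^r + Σ_r R^r_{1j} · ∂/∂y^r, where R^r_{1j} := δM^r/δx^j − δN^r_j/δt. -/
noncomputable section
open scoped BigOperators

/-- The local model `E = ℝ × (Fin n → ℝ) × (Fin n → ℝ)` of the 1-jet space `J¹(ℝ,M)`,
with coordinates `(t, x, y)`. -/
abbrev E (n : ℕ) : Type := ℝ × (Fin n → ℝ) × (Fin n → ℝ)

variable {n : ℕ}

/-- Partial derivative `∂f/∂t`. -/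
def pT (f : E n → ℝ) (p : E n) : ℝ := fderiv ℝ f p (1, 0, 0)

/-- Partial derivative `∂f/∂x^i`. -/
def pX (f : E n → ℝ) (i : Fin n) (p : E n) : ℝ := fderiv ℝ f p (0, Pi.single i 1, 0)

/-- Partial derivative `∂f/∂y^i`. -/
def pY (f : E n → ℝ) (i : Fin n) (p : E n) : ℝ := fderiv ℝ f p (0, 0, Pi.single i 1)

/-- The adapted temporal frame field `δ/δt = ∂/∂t - Σ_j M^j ∂/∂y^j`. -/
def delT (M : E n → Fin n → ℝ) (p : E n) : E n := (1, 0, fun j => -(M p j))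

/-- The adapted spatial frame field `δ/δx^i = ∂/∂x^i - Σ_j N^j_i ∂/∂y^j`. -/
def delX (N : E n → Fin n → Fin n → ℝ) (i : Fin n) (p : E n) : E n :=
  (0, Pi.single i 1, fun j => -(N p i j))

/-- The vertical frame field `∂/∂y^i`. -/
def delY (i : Fin n) (p : E n) : E n := ((0 : ℝ), (0 : Fin n → ℝ), Pi.single i 1)

/-- The Lie bracket `[X,Y](p) = (DY)(p)(X(p)) - (DX)(p)(Y(p))` of vector fields on `E`. -/
def lieBr (X Y : E n → E n) (p : E n) : E n := fderiv ℝ Y p (X p) - fderiv ℝ X p (Y p)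

/-- `δf/δt := ∂f/∂t - Σ_k M^k ∂f/∂y^k`. -/
def dT (M : E n → Fin n → ℝ) (f : E n → ℝ) (p : E n) : ℝ :=
  pT f p - ∑ k, M p k * pY f k p

/-- `δf/δx^i := ∂f/∂x^i - Σ_k N^k_i ∂f/∂y^k`. -/
def dX (N : E n → Fin n → Fin n → ℝ) (f : E n → ℝ) (i : Fin n) (p : E n) : ℝ :=
  pX f i p - ∑ k, N p i k * pY f k p

/-- A d-vector field `X = a·δ/δt + Σ_i b^i·δ/δx^i + Σ_i c^i·∂/∂y^i`
given by its adapted components. -/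
structure DVF (n : ℕ) where
  a : E n → ℝ
  b : E n → Fin n → ℝ
  c : E n → Fin n → ℝ

/-- The actual vector field on `E` determined by the adapted components of a `DVF`. -/
def DVF.realize (M : E n → Fin n → ℝ) (N : E n → Fin n → Fin n → ℝ) (X : DVF n)
    (p : E n) : E n :=
  (X.a p, X.b p, fun j => X.c p j - X.a p * M p j - ∑ i, X.b p i * N p i j)

/-- The nine families of adapted coefficients of a Γ-linear connection `∇`:
`Ḡ¹₁₁, G^k_{i1}, G^{(k)(1)}_{(1)(i)1}, L̄¹_{1j}, L^k_{ij}, L^{(k)(1)}_{(1)(i)j},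
C̄^{1(1)}_{1(j)}, C^{k(1)}_{i(j)}, C^{(k)(1)(1)}_{(1)(i)(j)}`. -/
structure Conn (n : ℕ) where
  Gbar : E n → ℝ
  G : E n → Fin n → Fin n → ℝ
  Gv : E n → Fin n → Fin n → ℝ
  Lbar : E n → Fin n → ℝ
  L : E n → Fin n → Fin n → Fin n → ℝ
  Lv : E n → Fin n → Fin n → Fin n → ℝ
  Cbar : E n → Fin n → ℝ
  C : E n → Fin n → Fin n → Fin n → ℝ
  Cv : E n → Fin n → Fin n → Fin n → ℝ

/-- All nine coefficient families are smooth. -/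
def Conn.Smooth (K : Conn n) : Prop :=
  ContDiff ℝ (⊤ : ℕ∞) K.Gbar ∧ ContDiff ℝ (⊤ : ℕ∞) K.G ∧ ContDiff ℝ (⊤ : ℕ∞) K.Gv ∧ ContDiff ℝ (⊤ : ℕ∞) K.Lbar ∧
  ContDiff ℝ (⊤ : ℕ∞) K.L ∧ ContDiff ℝ (⊤ : ℕ∞) K.Lv ∧ ContDiff ℝ (⊤ : ℕ∞) K.Cbar ∧ ContDiff ℝ (⊤ : ℕ∞) K.C ∧
  ContDiff ℝ (⊤ : ℕ∞) K.Cv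

/-- Derivative `X(f)(p) := Df(p)(X(p))` of `f` along the realized vector field of `X`. -/
def Xder (M : E n → Fin n → ℝ) (N : E n → Fin n → Fin n → ℝ) (X : DVF n) (f : E n → ℝ)
    (p : E n) : ℝ := fderiv ℝ f p (X.realize M N p)

/-- The Γ-linear connection `∇_X W` in adapted components. -/
def nabla (M : E n → Fin n → ℝ) (N : E n → Fin n → Fin n → ℝ) (K : Conn n)
    (X W : DVF n) : DVF n where
  a := fun p => Xder M N X W.a p +
    W.a p * (X.a p * K.Gbar p + ∑ j, X.b p j * K.Lbar p j + ∑ j, X.c p j * K.Cbar p j)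
  b := fun p k => Xder M N X (fun q => W.b q k) p +
    ∑ i, W.b p i *
      (X.a p * K.G p k i + ∑ j, X.b p j * K.L p k i j + ∑ j, X.c p j * K.C p k i j)
  c := fun p k => Xder M N X (fun q => W.c q k) p +
    ∑ i, W.c p i *
      (X.a p * K.Gv p k i + ∑ j, X.b p j * K.Lv p k i j + ∑ j, X.c p j * K.Cv p k i j)

/-- The adapted frame field `δ/δt` as a `DVF`. -/
def frT : DVF n := ⟨fun _ => 1, fun _ => 0, fun _ => 0⟩

/-- The adapted frame field `δ/δx^i` as a `DVF`. -/
def frX (i : Fin n) : DVF n := ⟨fun _ => 0, fun _ => Pi.single i 1, fun _ => 0⟩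

/-- The adapted frame field `∂/∂y^i` as a `DVF`. -/
def frY (i : Fin n) : DVF n := ⟨fun _ => 0, fun _ => 0, fun _ => Pi.single i 1⟩

/-- Decomposition of an arbitrary vector field into adapted components. -/
def decomp (M : E n → Fin n → ℝ) (N : E n → Fin n → Fin n → ℝ) (V : E n → E n) : DVF n :=
  ⟨fun p => (V p).1, fun p => (V p).2.1,
   fun p j => (V p).2.2 j + (V p).1 * M p j + ∑ i, (V p).2.1 i * N p i j⟩

/-- The torsion `T(X,Y) := ∇_X Y - ∇_Y X - [X,Y]`. -/
def torsion (M : E n → Fin n → ℝ) (N : E n → Fin n → Fin n → ℝ) (K : Conn n)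
    (X Y : DVF n) (p : E n) : E n :=
  (nabla M N K X Y).realize M N p - (nabla M N K Y X).realize M N p -
    lieBr (X.realize M N) (Y.realize M N) p

/-- The curvature `R(X,Y)Z := ∇_X(∇_Y Z) - ∇_Y(∇_X Z) - ∇_{[X,Y]}Z`. -/
def curv (M : E n → Fin n → ℝ) (N : E n → Fin n → Fin n → ℝ) (K : Conn n)
    (X Y Z : DVF n) (p : E n) : E n :=
  (nabla M N K X (nabla M N K Y Z)).realize M N p -
    (nabla M N K Y (nabla M N K X Z)).realize M N p -
    (nabla M N K (decomp M N (lieBr (X.realize M N) (Y.realize M N))) Z).realize M N p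

theorem fderiv_delT_apply (M : E n → Fin n → ℝ) (f : E n → ℝ) (p : E n) :
    fderiv ℝ f p (delT M p) = dT M f p := by
  have h : delT M p = ((1, 0, 0) : E n) - ∑ k, M p k • delY k p := by
    refine Prod.ext ?_ (Prod.ext ?_ ?_)
    · simp [delT, delY, Prod.fst_sum]
    · simp [delT, delY, Prod.fst_sum, Prod.snd_sum]
    · ext r
      simp [delT, delY, Prod.snd_sum, Finset.sum_apply, Pi.single_apply]
  rw [h]
  simp [dT, pT, pY, delY, map_sub, map_sum, -Prod.smul_mk]

theorem fderiv_delX_apply (N : E n → Fin n → Fin n → ℝ) (f : E n → ℝ) (i : Fin n) (p : E n) :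
    fderiv ℝ f p (delX N i p) = dX N f i p := by
  have h : delX N i p = ((0, Pi.single i 1, 0) : E n) - ∑ k, N p i k • delY k p := by
    refine Prod.ext ?_ (Prod.ext ?_ ?_)
    · simp [delX, delY, Prod.fst_sum]
    · simp [delX, delY, Prod.fst_sum, Prod.snd_sum]
    · ext r
      simp [delX, delY, Prod.snd_sum, Finset.sum_apply, Pi.single_apply]
  rw [h]
  simp [dX, pX, pY, delY, map_sub, map_sum, -Prod.smul_mk]

theorem realize_frT (M : E n → Fin n → ℝ) (N : E n → Fin n → Fin n → ℝ) :
    frT.realize M N = delT M := by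
  ext p <;> simp [DVF.realize, frT, delT]

theorem realize_frX (M : E n → Fin n → ℝ) (N : E n → Fin n → Fin n → ℝ) (j : Fin n) :
    (frX j).realize M N = delX N j := by
  ext p <;> simp [DVF.realize, frX, delX, Pi.single_apply]

theorem realize_nabla_frX_frT (M : E n → Fin n → ℝ) (N : E n → Fin n → Fin n → ℝ)
    (K : Conn n) (j : Fin n) (p : E n) :
    (nabla M N K (frX j) frT).realize M N p = K.Lbar p j • delT M p := by
  ext <;> simp [DVF.realize, nabla, frX, frT, delT, Xder, Pi.single_apply]

theorem realize_nabla_frT_frX (M : E n → Fin n → ℝ) (N : E n → Fin n → Fin n → ℝ)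
    (K : Conn n) (j : Fin n) (p : E n) :
    (nabla M N K frT (frX j)).realize M N p = ∑ r, K.G p r j • delX N r p := by
  ext <;> simp [DVF.realize, nabla, frX, frT, delX, Xder, Pi.single_apply, Prod.fst_sum,
    Prod.snd_sum, Finset.sum_apply]

theorem fderiv_vertical_apply {a : ℝ} {b : Fin n → ℝ} {F : E n → Fin n → ℝ} {p : E n}
    (hF : DifferentiableAt ℝ F p) (v : E n) :
    fderiv ℝ (fun q => ((a, b, fun r => -(F q r)) : E n)) p v =
      (0, 0, fun r => -(fderiv ℝ (fun q => F q r) p v)) := by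
  have hneg : HasFDerivAt (fun q r => -(F q r)) (-fderiv ℝ F p) p := hF.hasFDerivAt.neg
  rw [((hasFDerivAt_const a p).prodMk ((hasFDerivAt_const b p).prodMk hneg)).fderiv]
  refine Prod.ext rfl (Prod.ext rfl (funext fun r => ?_))
  have hr := (hasFDerivAt_pi'.1 hF.hasFDerivAt r).fderiv
  simp [hr]

theorem lieBr_delX_delT {M : E n → Fin n → ℝ} {N : E n → Fin n → Fin n → ℝ}
    (j : Fin n) {p : E n} (hM : DifferentiableAt ℝ M p)
    (hN : DifferentiableAt ℝ (fun q => N q j) p) :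
    lieBr (delX N j) (delT M) p =
      -∑ r, (dX N (fun q => M q r) j p - dT M (fun q => N q j r) p) • delY r p := by
  have hT : fderiv ℝ (delT M) p (delX N j p) = _ := fderiv_vertical_apply hM _
  have hX : fderiv ℝ (delX N j) p (delT M p) = _ := fderiv_vertical_apply hN _
  rw [lieBr, hT, hX]
  simp only [fderiv_delX_apply, fderiv_delT_apply]
  ext <;> simp [delY, Prod.fst_sum, Prod.snd_sum, Finset.sum_apply, Pi.single_apply]
  ring

/-- `T(δ/δx^j, δ/δt) = L̄_j·δ/δt − Σ_r G^r_j·δ/δx^r + Σ_r R^r_{1j}·∂/∂y^r`,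
where `R^r_{1j} := δM^r/δx^j − δN^r_j/δt`. -/
theorem torsion_delX_delT (n : ℕ) (M : E n → Fin n → ℝ) (N : E n → Fin n → Fin n → ℝ)
    (hM : ContDiff ℝ (⊤ : ℕ∞) M) (hN : ContDiff ℝ (⊤ : ℕ∞) N) (K : Conn n) (hK : K.Smooth) (j : Fin n) :
    torsion M N K (frX j) frT = fun p =>
      K.Lbar p j • delT M p - (∑ r, K.G p r j • delX N r p) +
        ∑ r, (dX N (fun q => M q r) j p - dT M (fun q => N q j r) p) • delY r p := by
  funext p
  have hMp : DifferentiableAt ℝ M p := hM.differentiable (by simp) p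
  have hNp : DifferentiableAt ℝ (fun q => N q j) p :=
    differentiableAt_pi.1 (hN.differentiable (by simp) p) j
  rw [torsion, realize_nabla_frX_frT, realize_nabla_frT_frX, realize_frX, realize_frT,
    lieBr_delX_delT j hMp hNp, sub_neg_eq_add]
end
end

section
/- The curvature of the Γ-linear connection ∇ satisfies, for all i, j, k: R(∂/∂y^k, ∂/∂y^j) δ/δx^i = Σ_l S^l_{ijk} · δ/δx^l, where S^l_{ijk} := ∂C^l_{ij}/∂y^k − ∂C^l_{ik}/∂y^j + Σ_r (C^r_{ij} C^l_{rk} − C^r_{ik} C^l_{rj}). -/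
noncomputable section
open scoped BigOperators

variable {n : ℕ}

/-- `∂/∂y^k` as a vector field on `E` is independent of the nonlinear connection. -/
lemma frY_realize (M : E n → Fin n → ℝ) (N : E n → Fin n → Fin n → ℝ) (k : Fin n) :
    (frY k).realize M N = fun _ => ((0 : ℝ), (0 : Fin n → ℝ), (Pi.single k 1 : Fin n → ℝ)) := by
  funext p
  simp [DVF.realize, frY]

/-- `∇_{∂/∂y^k}` of a horizontal spatial field `Σ_i b^i δ/δx^i`. -/
lemma nabla_frY_spatial (M : E n → Fin n → ℝ) (N : E n → Fin n → Fin n → ℝ) (K : Conn n)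
    (k : Fin n) (b : E n → Fin n → ℝ) :
    nabla M N K (frY k) ⟨fun _ => 0, b, fun _ => 0⟩ =
      ⟨fun _ => 0, fun p l => pY (fun q => b q l) k p + ∑ r, b p r * K.C p l r k,
        fun _ => 0⟩ := by
  unfold nabla
  congr 1
  · funext p
    simp [Xder]
  · funext p l
    simp only [Xder, frY_realize, pY]
    simp [frY, Pi.single_apply]
  · funext p l
    simp [Xder]

/-- `∇_{∂/∂y^k} δ/δx^i = Σ_l C^l_{ik} δ/δx^l`. -/
lemma nabla_frY_frX (M : E n → Fin n → ℝ) (N : E n → Fin n → Fin n → ℝ) (K : Conn n)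
    (i k : Fin n) :
    nabla M N K (frY k) (frX i) = ⟨fun _ => 0, fun p l => K.C p l i k, fun _ => 0⟩ := by
  rw [frX, nabla_frY_spatial]
  congr 1
  funext p l
  simp [pY, Pi.single_apply]

/-- The vertical frame fields commute. -/
lemma lieBr_frY_frY (M : E n → Fin n → ℝ) (N : E n → Fin n → Fin n → ℝ) (j k : Fin n) :
    lieBr ((frY k).realize M N) ((frY j).realize M N) = 0 := by
  funext p
  simp [lieBr, frY_realize]

/-- Covariant differentiation along the zero vector field vanishes. -/
lemma nabla_decomp_zero (M : E n → Fin n → ℝ) (N : E n → Fin n → Fin n → ℝ) (K : Conn n)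
    (W : DVF n) :
    nabla M N K (decomp M N 0) W = ⟨fun _ => 0, fun _ => 0, fun _ => 0⟩ := by
  have h (p : E n) : (decomp M N 0).realize M N p = 0 := by
    ext <;> simp [DVF.realize, decomp]
  unfold nabla
  congr 1
  · funext p
    simp [Xder, h]
    simp [decomp]
  · funext p l
    simp [Xder, h]
    simp [decomp]
  · funext p l
    simp [Xder, h]
    simp [decomp]

/-- A horizontal spatial field is the combination of the `δ/δx^l` with its components. -/
lemma realize_spatial (M : E n → Fin n → ℝ) (N : E n → Fin n → Fin n → ℝ)
    (b : E n → Fin n → ℝ) (p : E n) :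
    (⟨fun _ => 0, b, fun _ => 0⟩ : DVF n).realize M N p = ∑ l, b p l • delX N l p := by
  ext s
  · simp [DVF.realize, delX, Prod.fst_sum]
  · simp [DVF.realize, delX, Prod.fst_sum, Prod.snd_sum, Finset.sum_apply, Pi.single_apply]
  · simp [DVF.realize, delX, Prod.snd_sum, Finset.sum_apply]

/-- `R(∂/∂y^k, ∂/∂y^j) δ/δx^i = Σ_l S^l_{ijk}·δ/δx^l`, where
`S^l_{ijk} := ∂C^l_{ij}/∂y^k − ∂C^l_{ik}/∂y^j + Σ_r (C^r_{ij} C^l_{rk} − C^r_{ik} C^l_{rj})`. -/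
theorem curv_delY_delY_delX (n : ℕ) (M : E n → Fin n → ℝ) (N : E n → Fin n → Fin n → ℝ)
    (hM : ContDiff ℝ (⊤ : ℕ∞) M) (hN : ContDiff ℝ (⊤ : ℕ∞) N) (K : Conn n) (hK : K.Smooth) (i j k : Fin n) :
    curv M N K (frY k) (frY j) (frX i) = fun p =>
      ∑ l, (pY (fun q => K.C q l i j) k p - pY (fun q => K.C q l i k) j p
        + ∑ r, (K.C p r i j * K.C p l r k - K.C p r i k * K.C p l r j)) • delX N l p := by
  funext p
  rw [curv, nabla_frY_frX, nabla_frY_frX, nabla_frY_spatial, nabla_frY_spatial, lieBr_frY_frY,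
    nabla_decomp_zero, realize_spatial, realize_spatial]
  have hzero : (⟨fun _ => 0, fun _ => 0, fun _ => 0⟩ : DVF n).realize M N p = 0 := by
    ext <;> simp [DVF.realize]
  rw [hzero, sub_zero, ← Finset.sum_sub_distrib]
  refine Finset.sum_congr rfl fun l _ => ?_
  rw [← sub_smul, Finset.sum_sub_distrib]
  congr 1
  ring
end
end

section
/- For the Berwald connection BΓ̊ attached to the metrics h₁₁(t) and φ_{ij}(x), all adapted torsion d-tensors vanish except the spatial curvature component: T(δ/δt, δ/δt) = 0, T(δ/δx^j, δ/δt) = 0, T(∂/∂y^j, δ/δt) = 0, T(∂/∂y^j, δ/δx^i) = 0, and T(∂/∂y^j, ∂/∂y^i) = 0 for all i, j, while T(δ/δx^j, δ/δx^i) = Σ_k (Σ_m 𝔑^k_{mij}(x) · y^m) · ∂/∂y^k, where 𝔑^k_{mij} := ∂γ^k_{mi}/∂x^j − ∂γ^k_{mj}/∂x^i + Σ_r (γ^r_{mi} γ^k_{rj} − γ^r_{mj} γ^k_{ri}) is the classical curvature tensor of the spatial metric. -/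
noncomputable section
open scoped BigOperators

variable {n : ℕ}

/-- The temporal coefficients `M̊^j = −H(t)·y^j` of the canonical nonlinear connection. -/
def berM (H : ℝ → ℝ) : E n → Fin n → ℝ := fun p j => -(H p.1) * p.2.2 j

/-- The spatial coefficients `N̊^j_i = Σ_m γ^j_{im}(x)·y^m` of the canonical nonlinear
connection. -/
def berN (γ : (Fin n → ℝ) → Fin n → Fin n → Fin n → ℝ) : E n → Fin n → Fin n → ℝ :=
  fun p i j => ∑ m, γ p.2.1 j i m * p.2.2 m

/-- The Berwald connection `BΓ̊` attached to the metrics `h₁₁(t)` and `φ_{ij}(x)`: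
`Ḡ = H`, `Gv^k_i = −δ^k_i H`, `L^k_{ij} = Lv^k_{ij} = γ^k_{ij}`, all other
coefficients zero. -/
def berConn (H : ℝ → ℝ) (γ : (Fin n → ℝ) → Fin n → Fin n → Fin n → ℝ) : Conn n where
  Gbar := fun p => H p.1
  G := fun _ _ _ => 0
  Gv := fun p k i => -(if k = i then (1 : ℝ) else 0) * H p.1
  Lbar := fun _ _ => 0
  L := fun p k i j => γ p.2.1 k i j
  Lv := fun p k i j => γ p.2.1 k i j
  Cbar := fun _ _ => 0
  C := fun _ _ _ _ => 0
  Cv := fun _ _ _ _ => 0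

/-- The classical curvature tensor
`𝔑^l_{ijk} := ∂γ^l_{ij}/∂x^k − ∂γ^l_{ik}/∂x^j + Σ_r (γ^r_{ij} γ^l_{rk} − γ^r_{ik} γ^l_{rj})`
of the spatial metric. -/
def frakR (γ : (Fin n → ℝ) → Fin n → Fin n → Fin n → ℝ) (x : Fin n → ℝ)
    (l i j k : Fin n) : ℝ :=
  fderiv ℝ (fun z => γ z l i j) x (Pi.single k 1)
    - fderiv ℝ (fun z => γ z l i k) x (Pi.single j 1)
    + ∑ r, (γ x r i j * γ x l r k - γ x r i k * γ x l r j)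

theorem realize_frT_s13 (H : ℝ → ℝ) (γ : (Fin n → ℝ) → Fin n → Fin n → Fin n → ℝ) :
    frT.realize (berM H) (berN γ) = fun p : E n => (1, 0, fun j => H p.1 * p.2.2 j) := by
  funext p
  simp [DVF.realize, frT, berM]

theorem realize_frX_s13 (H : ℝ → ℝ) (γ : (Fin n → ℝ) → Fin n → Fin n → Fin n → ℝ) (i : Fin n) :
    (frX i).realize (berM H) (berN γ) =
      fun p : E n => (0, Pi.single i 1, fun j => -∑ m, γ p.2.1 j i m * p.2.2 m) := by
  funext p
  simp [DVF.realize, frX, berN, Pi.single_apply]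

theorem realize_frY (M : E n → Fin n → ℝ) (N : E n → Fin n → Fin n → ℝ) (i : Fin n) :
    (frY i).realize M N = fun _ : E n => (0, 0, Pi.single i 1) := by
  funext p
  simp [DVF.realize, frY]

theorem fderiv_realize_frT {H : ℝ → ℝ} (hH : Differentiable ℝ H)
    (γ : (Fin n → ℝ) → Fin n → Fin n → Fin n → ℝ) (p v : E n) :
    fderiv ℝ (frT.realize (berM H) (berN γ)) p v =
      (0, 0, fun j => fderiv ℝ H p.1 v.1 * p.2.2 j + H p.1 * v.2.2 j) := by
  have h (j : Fin n) := (((hH p.1).hasFDerivAt.comp p hasFDerivAt_fst).mul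
    ((hasFDerivAt_apply j p.2.2).comp p (hasFDerivAt_snd.comp p hasFDerivAt_snd)))
  rw [realize_frT_s13]
  have h' := (hasFDerivAt_const (1 : ℝ) p).prodMk
    ((hasFDerivAt_const (0 : Fin n → ℝ) p).prodMk (hasFDerivAt_pi.2 h))
  refine (congrArg (· v) h'.fderiv).trans ?_
  ext j <;> simp
  ring

theorem fderiv_realize_frX (H : ℝ → ℝ) {γ : (Fin n → ℝ) → Fin n → Fin n → Fin n → ℝ}
    (hγ : Differentiable ℝ γ) (i : Fin n) (p v : E n) :
    fderiv ℝ ((frX i).realize (berM H) (berN γ)) p v =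
      (0, 0, fun j => -∑ m, (fderiv ℝ (fun z => γ z j i m) p.2.1 v.2.1 * p.2.2 m +
        γ p.2.1 j i m * v.2.2 m)) := by
  have hd (j m : Fin n) : Differentiable ℝ (fun z => γ z j i m) := by fun_prop
  have hx := hasFDerivAt_fst.comp p (hasFDerivAt_snd (𝕜 := ℝ) (p := p))
  have h (j : Fin n) := (HasFDerivAt.fun_sum (u := Finset.univ) fun m _ =>
    ((hd j m p.2.1).hasFDerivAt.comp p hx).mul
    ((hasFDerivAt_apply m p.2.2).comp p (hasFDerivAt_snd.comp p hasFDerivAt_snd))).neg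
  rw [realize_frX_s13]
  have h' := (hasFDerivAt_const (0 : ℝ) p).prodMk
    ((hasFDerivAt_const (Pi.single i 1 : Fin n → ℝ) p).prodMk (hasFDerivAt_pi.2 h))
  refine (congrArg (· v) h'.fderiv).trans ?_
  ext j <;> simp [← Finset.sum_neg_distrib]
  refine Finset.sum_congr rfl fun m _ => ?_
  ring

theorem fderiv_realize_frY (M : E n → Fin n → ℝ) (N : E n → Fin n → Fin n → ℝ) (i : Fin n)
    (p v : E n) : fderiv ℝ ((frY i).realize M N) p v = 0 := by
  simp [realize_frY]

/-- A frame field has constant adapted components, so its covariant derivatives only involve the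
connection coefficients. -/
theorem nabla_const (M : E n → Fin n → ℝ) (N : E n → Fin n → Fin n → ℝ) (K : Conn n)
    (X : DVF n) (a : ℝ) (b c : Fin n → ℝ) :
    nabla M N K X ⟨fun _ => a, fun _ => b, fun _ => c⟩ =
      { a := fun p => a *
          (X.a p * K.Gbar p + ∑ j, X.b p j * K.Lbar p j + ∑ j, X.c p j * K.Cbar p j)
        b := fun p k => ∑ i, b i *
          (X.a p * K.G p k i + ∑ j, X.b p j * K.L p k i j + ∑ j, X.c p j * K.C p k i j)
        c := fun p k => ∑ i, c i *
          (X.a p * K.Gv p k i + ∑ j, X.b p j * K.Lv p k i j + ∑ j, X.c p j * K.Cv p k i j) } := by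
  simp [nabla, Xder]

/-- For the Berwald connection all adapted torsion d-tensors vanish
except `T(δ/δx^j, δ/δx^i) = Σ_k (Σ_m 𝔑^k_{mij}(x)·y^m)·∂/∂y^k`. -/
theorem berwald_torsion (n : ℕ) (H : ℝ → ℝ) (γ : (Fin n → ℝ) → Fin n → Fin n → Fin n → ℝ)
    (hH : ContDiff ℝ (⊤ : ℕ∞) H) (hγ : ContDiff ℝ (⊤ : ℕ∞) γ)
    (hsym : ∀ (x : Fin n → ℝ) (i j k : Fin n), γ x i j k = γ x i k j) :
    torsion (berM H) (berN γ) (berConn H γ) frT frT = 0 ∧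
    (∀ j, torsion (berM H) (berN γ) (berConn H γ) (frX j) frT = 0) ∧
    (∀ j, torsion (berM H) (berN γ) (berConn H γ) (frY j) frT = 0) ∧
    (∀ i j, torsion (berM H) (berN γ) (berConn H γ) (frY j) (frX i) = 0) ∧
    (∀ i j, torsion (berM H) (berN γ) (berConn H γ) (frY j) (frY i) = 0) ∧
    (∀ i j, torsion (berM H) (berN γ) (berConn H γ) (frX j) (frX i) = fun p =>
      ∑ k, (∑ m, frakR γ p.2.1 k m i j * p.2.2 m) • delY k p) := by
  have hH' : Differentiable ℝ H := hH.differentiable (by simp)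
  have hγ' : Differentiable ℝ γ := hγ.differentiable (by simp)
  refine ⟨?_, fun j => ?_, fun j => ?_, fun i j => ?_, fun i j => ?_, fun i j => ?_⟩
  · funext p
    simp [torsion, lieBr]
  · funext p
    simp only [torsion, lieBr, fderiv_realize_frT hH', fderiv_realize_frX H hγ']
    simp only [frT, frX, nabla_const]
    ext k <;> simp [DVF.realize, berConn, berM, berN, Pi.single_apply, Finset.mul_sum]
    rw [neg_add_eq_zero]
    refine Finset.sum_congr rfl fun m _ => ?_
    ring
  · funext p
    simp only [torsion, lieBr, fderiv_realize_frT hH', fderiv_realize_frY]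
    simp only [frT, frY, nabla_const]
    ext k <;> simp [DVF.realize, berConn, Pi.single_apply]
  · funext p
    simp only [torsion, lieBr, fderiv_realize_frX H hγ', fderiv_realize_frY]
    simp only [frX, frY, nabla_const]
    ext k <;> simp [DVF.realize, berConn, Pi.single_apply]
    rw [hsym, neg_add_cancel]
  · funext p
    simp only [torsion, lieBr, fderiv_realize_frY]
    simp only [frY, nabla_const]
    ext k <;> simp [DVF.realize, berConn]
  · funext p
    simp only [torsion, lieBr, fderiv_realize_frX H hγ']
    simp only [frX, nabla_const]
    ext k
    · simp [DVF.realize, berConn, Prod.fst_sum, delY]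
    · simp [DVF.realize, berConn, Prod.fst_sum, Prod.snd_sum, delY, Pi.single_apply, hsym _ k i j]
    · simp [DVF.realize, berConn, Prod.snd_sum, delY, Pi.single_apply, frakR]
      have hγN (a b : Fin n) : ∑ r, γ p.2.1 k a r * berN γ p b r =
          ∑ m, (∑ r, γ p.2.1 r m b * γ p.2.1 k a r) * p.2.2 m := by
        simp only [berN, Finset.mul_sum, Finset.sum_mul]
        rw [Finset.sum_comm]
        refine Finset.sum_congr rfl fun m _ => Finset.sum_congr rfl fun r _ => ?_
        rw [hsym _ r b m]
        ring
      simp only [hsym _ _ j i, hsym _ k _ i, hsym _ k _ j, sub_mul, add_mul, Finset.sum_add_distrib,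
        Finset.sum_sub_distrib, Finset.sum_neg_distrib, hγN]
      ring
end
end

section
/- For the Berwald connection BΓ̊ attached to the metrics h₁₁(t) and φ_{ij}(x), all adapted curvature d-tensors vanish except two: R(δ/δx^k, δ/δx^j) δ/δx^i = Σ_l 𝔑^l_{ijk}(x) · δ/δx^l and R(δ/δx^k, δ/δx^j) ∂/∂y^i = Σ_l 𝔑^l_{ijk}(x) · ∂/∂y^l, while R(δ/δx^k, δ/δx^j) δ/δt = 0 and R(X, Y)Z = 0 for every adapted frame field Z whenever the pair (X,Y) is (δ/δt, δ/δt), (δ/δx^k, δ/δt), (∂/∂y^k, δ/δt), (∂/∂y^k, δ/δx^j), or (∂/∂y^k, ∂/∂y^j); here 𝔑^l_{ijk} := ∂γ^l_{ij}/∂x^k − ∂γ^l_{ik}/∂x^j + Σ_r (γ^r_{ij} γ^l_{rk} − γ^r_{ik} γ^l_{rj}) is the classical curvature tensor of the spatial metric. -/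
noncomputable section
open scoped BigOperators

variable {n : ℕ}

/-- The d-vector field with constant adapted components. -/
def constField (a : ℝ) (b c : Fin n → ℝ) : DVF n := ⟨fun _ => a, fun _ => b, fun _ => c⟩

/-- The contraction `Σ_{i,j,s} z^i v^j u^s 𝔑^l_{ijs}` of the spatial curvature tensor. -/
def contractR (γ : (Fin n → ℝ) → Fin n → Fin n → Fin n → ℝ) (x u v z : Fin n → ℝ)
    (l : Fin n) : ℝ :=
  ∑ i, ∑ j, ∑ s, z i * v j * u s * frakR γ x l i j s

/-- The contraction `Σ_{i,j} z^i v^j γ^l_{ij}` of the Christoffel symbols. -/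
def contractΓ (γ : (Fin n → ℝ) → Fin n → Fin n → Fin n → ℝ) (v z x : Fin n → ℝ)
    (l : Fin n) : ℝ :=
  ∑ i, z i * ∑ j, v j * γ x l i j

theorem differentiable_christoffel {γ : (Fin n → ℝ) → Fin n → Fin n → Fin n → ℝ}
    (hγ : Differentiable ℝ γ) (l i j : Fin n) : Differentiable ℝ fun z => γ z l i j := by
  fun_prop

theorem differentiable_contractΓ {γ : (Fin n → ℝ) → Fin n → Fin n → Fin n → ℝ}
    (hγ : Differentiable ℝ γ) (v z : Fin n → ℝ) (l : Fin n) :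
    Differentiable ℝ fun x => contractΓ γ v z x l := by
  unfold contractΓ
  fun_prop

theorem fderiv_contractΓ {γ : (Fin n → ℝ) → Fin n → Fin n → Fin n → ℝ}
    (hγ : Differentiable ℝ γ) (u v z x : Fin n → ℝ) (l : Fin n) :
    fderiv ℝ (fun x => contractΓ γ v z x l) x u =
      ∑ i, ∑ j, ∑ s, z i * v j * u s *
        fderiv ℝ (fun w => γ w l i j) x (Pi.single s 1) := by
  have hd := fun i j => (differentiable_christoffel hγ l i j).differentiableAt (x := x)
  have hu (i j : Fin n) : fderiv ℝ (fun w => γ w l i j) x u =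
      ∑ s, u s * fderiv ℝ (fun w => γ w l i j) x (Pi.single s 1) := by
    conv_lhs => rw [pi_eq_sum_univ' u]
    simp [map_sum, Pi.single]
  have h : HasFDerivAt (fun x => contractΓ γ v z x l)
      (∑ i, z i • ∑ j, v j • fderiv ℝ (fun w => γ w l i j) x) x :=
    HasFDerivAt.fun_sum fun i _ => (HasFDerivAt.fun_sum fun j _ =>
      ((hd i j).hasFDerivAt.const_mul (v j))).const_mul (z i)
  rw [h.fderiv]
  simp only [sum_apply, smul_apply, smul_eq_mul, hu,
    Finset.mul_sum, mul_assoc]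

theorem contractΓ_contractΓ (γ : (Fin n → ℝ) → Fin n → Fin n → Fin n → ℝ)
    (u v z x : Fin n → ℝ) (l : Fin n) :
    contractΓ γ u (contractΓ γ v z x) x l =
      ∑ i, ∑ j, ∑ s, z i * v j * u s * ∑ r, γ x r i j * γ x l r s := by
  have h (r : Fin n) : contractΓ γ v z x r * ∑ s, u s * γ x l r s =
      ∑ i, ∑ j, ∑ s, z i * v j * u s * (γ x r i j * γ x l r s) := by
    rw [contractΓ, Finset.sum_mul]
    refine Finset.sum_congr rfl fun i _ => ?_
    rw [mul_assoc, Finset.sum_mul_sum]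
    simp only [Finset.mul_sum]
    refine Finset.sum_congr rfl fun j _ => Finset.sum_congr rfl fun s _ => ?_
    ring
  rw [contractΓ, Finset.sum_congr rfl fun r _ => h r, Finset.sum_comm]
  refine Finset.sum_congr rfl fun i _ => ?_
  rw [Finset.sum_comm]
  refine Finset.sum_congr rfl fun j _ => ?_
  rw [Finset.sum_comm]
  simp only [Finset.mul_sum]

theorem contractR_eq {γ : (Fin n → ℝ) → Fin n → Fin n → Fin n → ℝ}
    (hγ : Differentiable ℝ γ) (u v z x : Fin n → ℝ) (l : Fin n) :
    contractR γ x u v z l =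
      (fderiv ℝ (fun x => contractΓ γ v z x l) x u + contractΓ γ u (contractΓ γ v z x) x l) -
      (fderiv ℝ (fun x => contractΓ γ u z x l) x v +
        contractΓ γ v (contractΓ γ u z x) x l) := by
  have hswap (f : Fin n → Fin n → Fin n → ℝ) :
      ∑ i, ∑ j, ∑ s, z i * u j * v s * f i j s = ∑ i, ∑ j, ∑ s, z i * v j * u s * f i s j := by
    refine Finset.sum_congr rfl fun i _ => ?_
    rw [Finset.sum_comm]
    simp only [mul_right_comm (z i)]
  rw [fderiv_contractΓ hγ, fderiv_contractΓ hγ, contractΓ_contractΓ, contractΓ_contractΓ,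
    hswap fun i j s => fderiv ℝ (fun w => γ w l i j) x (Pi.single s 1),
    hswap fun i j s => ∑ r, γ x r i j * γ x l r s]
  simp only [contractR, frakR, ← Finset.sum_sub_distrib, ← Finset.sum_add_distrib]
  refine Finset.sum_congr rfl fun i _ => Finset.sum_congr rfl fun j _ =>
    Finset.sum_congr rfl fun s _ => ?_
  rw [Finset.sum_sub_distrib]
  ring

theorem nabla_berwald_a (M : E n → Fin n → ℝ) (N : E n → Fin n → Fin n → ℝ) (H : ℝ → ℝ)
    (γ : (Fin n → ℝ) → Fin n → Fin n → Fin n → ℝ) (X W : DVF n) (p : E n) :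
    (nabla M N (berConn H γ) X W).a p = Xder M N X W.a p + W.a p * (X.a p * H p.1) := by
  simp [nabla, berConn]

theorem nabla_berwald_b (M : E n → Fin n → ℝ) (N : E n → Fin n → Fin n → ℝ) (H : ℝ → ℝ)
    (γ : (Fin n → ℝ) → Fin n → Fin n → Fin n → ℝ) (X W : DVF n) (p : E n) (k : Fin n) :
    (nabla M N (berConn H γ) X W).b p k =
      Xder M N X (fun q => W.b q k) p + contractΓ γ (X.b p) (W.b p) p.2.1 k := by
  simp [nabla, berConn, contractΓ]

theorem nabla_berwald_c (M : E n → Fin n → ℝ) (N : E n → Fin n → Fin n → ℝ) (H : ℝ → ℝ)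
    (γ : (Fin n → ℝ) → Fin n → Fin n → Fin n → ℝ) (X W : DVF n) (p : E n) (k : Fin n) :
    (nabla M N (berConn H γ) X W).c p k =
      Xder M N X (fun q => W.c q k) p - X.a p * H p.1 * W.c p k +
        contractΓ γ (X.b p) (W.c p) p.2.1 k := by
  simp [nabla, berConn, contractΓ, mul_add, Finset.sum_add_distrib]
  ring

theorem differentiable_realize_constField {M : E n → Fin n → ℝ} {N : E n → Fin n → Fin n → ℝ}
    (hM : Differentiable ℝ M) (hN : Differentiable ℝ N) (a : ℝ) (b c : Fin n → ℝ) :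
    Differentiable ℝ ((constField a b c).realize M N) := by
  unfold DVF.realize constField
  fun_prop

/-- The derivative of the realization of a constant field is vertical. -/
theorem fderiv_realize_constField {M : E n → Fin n → ℝ} {N : E n → Fin n → Fin n → ℝ}
    (hM : Differentiable ℝ M) (hN : Differentiable ℝ N) (a : ℝ) (b c : Fin n → ℝ) (p v : E n) :
    (fderiv ℝ ((constField a b c).realize M N) p v).1 = 0 ∧
      (fderiv ℝ ((constField a b c).realize M N) p v).2.1 = 0 := by
  have h := (differentiable_realize_constField hM hN a b c p).hasFDerivAt
  have h1 := h.fst.unique (hasFDerivAt_const a p)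
  have h2 := h.snd.fst.unique (hasFDerivAt_const b p)
  exact ⟨DFunLike.congr_fun h1 v, DFunLike.congr_fun h2 v⟩

theorem Xder_const (M : E n → Fin n → ℝ) (N : E n → Fin n → Fin n → ℝ) (X : DVF n) (r : ℝ)
    (p : E n) : Xder M N X (fun _ => r) p = 0 := by
  simp [Xder]

/-- The derivative of a function of `x` alone along a vector field. -/
theorem Xder_comp_x (M : E n → Fin n → ℝ) (N : E n → Fin n → Fin n → ℝ) (X : DVF n)
    {f : (Fin n → ℝ) → ℝ} (hf : Differentiable ℝ f) (p : E n) :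
    Xder M N X (fun q => f q.2.1) p = fderiv ℝ f p.2.1 (X.b p) := by
  have h : HasFDerivAt (fun q : E n => f q.2.1) _ p :=
    (hf p.2.1).hasFDerivAt.comp p (hasFDerivAt_id p).snd.fst
  rw [Xder, h.fderiv]
  rfl

/-- The derivative of a function of `t` alone along a vector field. -/
theorem Xder_comp_t (M : E n → Fin n → ℝ) (N : E n → Fin n → Fin n → ℝ) (X : DVF n)
    {f : ℝ → ℝ} (hf : Differentiable ℝ f) (p : E n) :
    Xder M N X (fun q => f q.1) p = X.a p * deriv f p.1 := by
  have h : HasFDerivAt (fun q : E n => f q.1) _ p :=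
    (hf p.1).hasFDerivAt.comp p (hasFDerivAt_id p).fst
  rw [Xder, h.fderiv]
  exact fderiv_eq_smul_deriv _

theorem Xder_add (M : E n → Fin n → ℝ) (N : E n → Fin n → Fin n → ℝ) (X : DVF n)
    {f g : E n → ℝ} (hf : Differentiable ℝ f) (hg : Differentiable ℝ g) (p : E n) :
    Xder M N X (fun q => f q + g q) p = Xder M N X f p + Xder M N X g p := by
  simp [Xder, fderiv_fun_add (hf p) (hg p)]

theorem contractΓ_zero_left (γ : (Fin n → ℝ) → Fin n → Fin n → Fin n → ℝ)
    (z x : Fin n → ℝ) (l : Fin n) : contractΓ γ 0 z x l = 0 := by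
  simp [contractΓ]

theorem contractΓ_lin (γ : (Fin n → ℝ) → Fin n → Fin n → Fin n → ℝ)
    (r : ℝ) (v z w x : Fin n → ℝ) (l : Fin n) :
    contractΓ γ v (fun k => r * z k + w k) x l =
      r * contractΓ γ v z x l + contractΓ γ v w x l := by
  simp only [contractΓ, add_mul, Finset.sum_add_distrib, Finset.mul_sum, mul_assoc]

/-- The curvature of the Berwald connection on fields with constant adapted components. -/
theorem curv_constField {H : ℝ → ℝ} {γ : (Fin n → ℝ) → Fin n → Fin n → Fin n → ℝ}
    (hH : Differentiable ℝ H) (hγ : Differentiable ℝ γ) (a a' a'' : ℝ)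
    (b b' b'' c c' c'' : Fin n → ℝ) (p : E n) :
    curv (berM H) (berN γ) (berConn H γ) (constField a b c) (constField a' b' c')
      (constField a'' b'' c'') p =
    (0, contractR γ p.2.1 b b' b'', fun l => contractR γ p.2.1 b b' c'' l -
      ∑ i, contractR γ p.2.1 b b' b'' i * berN γ p i l) := by
  have hM : Differentiable ℝ (berM (n := n) H) := by unfold berM; fun_prop
  have hN : Differentiable ℝ (berN γ) := by unfold berN; fun_prop
  set D := decomp (berM H) (berN γ) (lieBr ((constField a b c).realize (berM H) (berN γ))
    ((constField a' b' c').realize (berM H) (berN γ))) with hD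
  have hDa : D.a p = 0 := by
    simp [hD, decomp, lieBr, (fderiv_realize_constField hM hN _ _ _ _ _).1]
  have hDb : D.b p = 0 := by
    simp [hD, decomp, lieBr, (fderiv_realize_constField hM hN _ _ _ _ _).2]
  have hna (a' a'' : ℝ) (b' b'' c' c'' : Fin n → ℝ) :
      (nabla (berM H) (berN γ) (berConn H γ) (constField a' b' c')
        (constField a'' b'' c'')).a = fun q => a'' * a' * H q.1 := by
    funext q
    rw [nabla_berwald_a]
    simp only [constField, Xder_const]
    ring
  have hnb (a' a'' : ℝ) (b' b'' c' c'' : Fin n → ℝ) :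
      (nabla (berM H) (berN γ) (berConn H γ) (constField a' b' c')
        (constField a'' b'' c'')).b = fun q => contractΓ γ b' b'' q.2.1 := by
    funext q k
    rw [nabla_berwald_b]
    simp only [constField, Xder_const]
    ring
  have hnc (a' a'' : ℝ) (b' b'' c' c'' : Fin n → ℝ) :
      (nabla (berM H) (berN γ) (berConn H γ) (constField a' b' c')
        (constField a'' b'' c'')).c =
        fun q k => -a' * H q.1 * c'' k + contractΓ γ b' c'' q.2.1 k := by
    funext q k
    rw [nabla_berwald_c]
    simp only [constField, Xder_const]
    ring
  have hnna (a a' a'' : ℝ) (b b' b'' c c' c'' : Fin n → ℝ) :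
      (nabla (berM H) (berN γ) (berConn H γ) (constField a b c)
        (nabla (berM H) (berN γ) (berConn H γ) (constField a' b' c')
        (constField a'' b'' c''))).a p =
        a * a' * a'' * (deriv H p.1 + H p.1 * H p.1) := by
    rw [nabla_berwald_a, hna, Xder_comp_t (f := fun t => a'' * a' * H t) _ _ _ (by fun_prop)]
    simp only [constField, deriv_const_mul_field]
    ring
  have hnnb (a a' a'' : ℝ) (b b' b'' c c' c'' : Fin n → ℝ) (k : Fin n) :
      (nabla (berM H) (berN γ) (berConn H γ) (constField a b c)
        (nabla (berM H) (berN γ) (berConn H γ) (constField a' b' c')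
        (constField a'' b'' c''))).b p k =
        fderiv ℝ (fun x => contractΓ γ b' b'' x k) p.2.1 b +
          contractΓ γ b (contractΓ γ b' b'' p.2.1) p.2.1 k := by
    rw [nabla_berwald_b, hnb, Xder_comp_x _ _ _ (differentiable_contractΓ hγ b' b'' k)]
    rfl
  have hnnc (a a' a'' : ℝ) (b b' b'' c c' c'' : Fin n → ℝ) (k : Fin n) :
      (nabla (berM H) (berN γ) (berConn H γ) (constField a b c)
        (nabla (berM H) (berN γ) (berConn H γ) (constField a' b' c')
        (constField a'' b'' c''))).c p k =
        (fderiv ℝ (fun x => contractΓ γ b' c'' x k) p.2.1 b +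
          contractΓ γ b (contractΓ γ b' c'' p.2.1) p.2.1 k) +
        a * a' * (H p.1 * H p.1 - deriv H p.1) * c'' k -
        H p.1 * (a * contractΓ γ b' c'' p.2.1 k + a' * contractΓ γ b c'' p.2.1 k) := by
    have hd := differentiable_contractΓ hγ b' c'' k
    rw [nabla_berwald_c, hnc, Xder_add (f := fun q => -a' * H q.1 * c'' k)
        (g := fun q => contractΓ γ b' c'' q.2.1 k) _ _ _ (by fun_prop)
        (hd.comp (by fun_prop : Differentiable ℝ fun q : E n => q.2.1)),
      Xder_comp_t (f := fun t => -a' * H t * c'' k) _ _ _ (by fun_prop),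
      Xder_comp_x _ _ _ hd, contractΓ_lin]
    simp only [constField, deriv_mul_const_field, deriv_const_mul_field]
    ring
  have hDna : (nabla (berM H) (berN γ) (berConn H γ) D (constField a'' b'' c'')).a p = 0 := by
    rw [nabla_berwald_a, hDa]
    simp [constField, Xder_const]
  have hDnb : (nabla (berM H) (berN γ) (berConn H γ) D (constField a'' b'' c'')).b p = 0 := by
    funext k
    rw [nabla_berwald_b, hDb]
    simp [constField, Xder_const, contractΓ_zero_left]
  have hDnc : (nabla (berM H) (berN γ) (berConn H γ) D (constField a'' b'' c'')).c p = 0 := by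
    funext k
    rw [nabla_berwald_c, hDa, hDb]
    simp [constField, Xder_const, contractΓ_zero_left]
  refine Prod.ext ?_ (Prod.ext (funext fun l => ?_) (funext fun l => ?_))
  · simp only [curv, DVF.realize, Prod.fst_sub, ← hD, hnna, hDna]
    ring
  · simp only [curv, DVF.realize, Prod.fst_sub, Prod.snd_sub, Pi.sub_apply, ← hD, hnnb, hDnb,
      contractR_eq hγ, Pi.zero_apply, sub_zero]
  · simp only [curv, DVF.realize, Prod.snd_sub, Pi.sub_apply, ← hD, hnna, hnnb, hnnc, hDna,
      hDnb, hDnc, contractR_eq hγ, Pi.zero_apply, sub_mul, Finset.sum_sub_distrib, zero_mul,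
      Finset.sum_const_zero]
    ring

theorem contractR_zero_left (γ : (Fin n → ℝ) → Fin n → Fin n → Fin n → ℝ)
    (x v z : Fin n → ℝ) : contractR γ x 0 v z = 0 := by
  funext l; simp [contractR]

theorem contractR_zero_mid (γ : (Fin n → ℝ) → Fin n → Fin n → Fin n → ℝ)
    (x u z : Fin n → ℝ) : contractR γ x u 0 z = 0 := by
  funext l; simp [contractR]

theorem contractR_zero_right (γ : (Fin n → ℝ) → Fin n → Fin n → Fin n → ℝ)
    (x u v : Fin n → ℝ) : contractR γ x u v 0 = 0 := by
  funext l; simp [contractR]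

theorem contractR_single (γ : (Fin n → ℝ) → Fin n → Fin n → Fin n → ℝ)
    (x : Fin n → ℝ) (i j k l : Fin n) :
    contractR γ x (Pi.single k 1) (Pi.single j 1) (Pi.single i 1) l = frakR γ x l i j k := by
  simp [contractR, Pi.single_apply]

theorem frT_eq_constField : (frT : DVF n) = constField 1 0 0 := rfl

theorem frX_eq_constField (i : Fin n) : frX i = constField 0 (Pi.single i 1) 0 := rfl

theorem frY_eq_constField (i : Fin n) : frY i = constField 0 0 (Pi.single i 1) := rfl

/-- For the Berwald connection all adapted curvature d-tensors vanish
except `R(δ/δx^k, δ/δx^j) δ/δx^i = Σ_l 𝔑^l_{ijk}·δ/δx^l` and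
`R(δ/δx^k, δ/δx^j) ∂/∂y^i = Σ_l 𝔑^l_{ijk}·∂/∂y^l`. -/
theorem berwald_curvature (n : ℕ) (H : ℝ → ℝ) (γ : (Fin n → ℝ) → Fin n → Fin n → Fin n → ℝ)
    (hH : ContDiff ℝ (⊤ : ℕ∞) H) (hγ : ContDiff ℝ (⊤ : ℕ∞) γ)
    (hsym : ∀ (x : Fin n → ℝ) (i j k : Fin n), γ x i j k = γ x i k j) :
    (∀ i j k, curv (berM H) (berN γ) (berConn H γ) (frX k) (frX j) (frX i) = fun p =>
      ∑ l, frakR γ p.2.1 l i j k • delX (berN γ) l p) ∧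
    (∀ i j k, curv (berM H) (berN γ) (berConn H γ) (frX k) (frX j) (frY i) = fun p =>
      ∑ l, frakR γ p.2.1 l i j k • delY l p) ∧
    (∀ j k, curv (berM H) (berN γ) (berConn H γ) (frX k) (frX j) frT = 0) ∧
    (curv (berM H) (berN γ) (berConn H γ) frT frT frT = 0) ∧
    (∀ i, curv (berM H) (berN γ) (berConn H γ) frT frT (frX i) = 0) ∧
    (∀ i, curv (berM H) (berN γ) (berConn H γ) frT frT (frY i) = 0) ∧
    (∀ k, curv (berM H) (berN γ) (berConn H γ) (frX k) frT frT = 0) ∧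
    (∀ i k, curv (berM H) (berN γ) (berConn H γ) (frX k) frT (frX i) = 0) ∧
    (∀ i k, curv (berM H) (berN γ) (berConn H γ) (frX k) frT (frY i) = 0) ∧
    (∀ k, curv (berM H) (berN γ) (berConn H γ) (frY k) frT frT = 0) ∧
    (∀ i k, curv (berM H) (berN γ) (berConn H γ) (frY k) frT (frX i) = 0) ∧
    (∀ i k, curv (berM H) (berN γ) (berConn H γ) (frY k) frT (frY i) = 0) ∧
    (∀ j k, curv (berM H) (berN γ) (berConn H γ) (frY k) (frX j) frT = 0) ∧
    (∀ i j k, curv (berM H) (berN γ) (berConn H γ) (frY k) (frX j) (frX i) = 0) ∧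
    (∀ i j k, curv (berM H) (berN γ) (berConn H γ) (frY k) (frX j) (frY i) = 0) ∧
    (∀ j k, curv (berM H) (berN γ) (berConn H γ) (frY k) (frY j) frT = 0) ∧
    (∀ i j k, curv (berM H) (berN γ) (berConn H γ) (frY k) (frY j) (frX i) = 0) ∧
    (∀ i j k, curv (berM H) (berN γ) (berConn H γ) (frY k) (frY j) (frY i) = 0) := by
  have hH' : Differentiable ℝ H := hH.differentiable (by simp)
  have hγ' : Differentiable ℝ γ := hγ.differentiable (by simp)
  refine ⟨fun i j k => ?_, fun i j k => ?_, ?_⟩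
  · funext p
    rw [frX_eq_constField, frX_eq_constField, frX_eq_constField, curv_constField hH' hγ']
    refine Prod.ext ?_ (Prod.ext (funext fun l => ?_) (funext fun l => ?_)) <;>
      simp [Prod.fst_sum, Prod.snd_sum, delX, contractR_single, contractR_zero_right,
        Finset.sum_apply, Pi.single_apply]
  · funext p
    rw [frX_eq_constField, frX_eq_constField, frY_eq_constField, curv_constField hH' hγ']
    refine Prod.ext ?_ (Prod.ext (funext fun l => ?_) (funext fun l => ?_)) <;>
      simp [Prod.fst_sum, Prod.snd_sum, delY, contractR_single, contractR_zero_right,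
        Finset.sum_apply, Pi.single_apply]
  · refine ⟨?_, ?_, ?_, ?_, ?_, ?_, ?_, ?_, ?_, ?_, ?_, ?_, ?_, ?_, ?_, ?_⟩ <;> intros <;>
      funext p <;>
      simp only [frT_eq_constField, frX_eq_constField, frY_eq_constField,
        curv_constField hH' hγ', contractR_zero_left, contractR_zero_mid,
        contractR_zero_right, Pi.zero_apply, zero_mul, Finset.sum_const_zero, sub_zero] <;>
      rfl
end
end

section
/- Ricci identity (M-horizontal components, mixed temporal–spatial derivatives): for any smooth d-vector components X¹, X^i, X^{(i)} : E → ℝ and all i, k, one has X^i_{/1|k} − X^i_{|k/1} = Σ_r X^r R^i_{r1k} − X^i_{/1} T̄_k − Σ_r X^i_{|r} T^r_{1k} − Σ_r X^i|_{(r)} R^r_{1k}, where T̄_k := L̄_k, T^r_{1k} := −G^r_k, R^r_{1k} := δM^r/δx^k − δN^r_k/δt, and R^i_{r1k} := δG^i_r/δx^k − δL^i_{rk}/δt + Σ_s (G^s_r L^i_{sk} − L^s_{rk} G^i_s) + Σ_s C^i_{rs} R^s_{1k}. -/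
noncomputable section
open scoped BigOperators

variable {n : ℕ}

/-- `X^i_{/1} := δX^i/δt + Σ_r X^r G^i_r`. -/
def covTx (M : E n → Fin n → ℝ) (K : Conn n) (Xs : E n → Fin n → ℝ) (i : Fin n)
    (p : E n) : ℝ :=
  dT M (fun q => Xs q i) p + ∑ r, Xs p r * K.G p i r

/-- `X^i_{|j} := δX^i/δx^j + Σ_r X^r L^i_{rj}`. -/
def covXx (N : E n → Fin n → Fin n → ℝ) (K : Conn n) (Xs : E n → Fin n → ℝ) (i j : Fin n)
    (p : E n) : ℝ :=
  dX N (fun q => Xs q i) j p + ∑ r, Xs p r * K.L p i r j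

/-- `X^i|_{(j)} := ∂X^i/∂y^j + Σ_r X^r C^i_{rj}`. -/
def covYx (K : Conn n) (Xs : E n → Fin n → ℝ) (i j : Fin n) (p : E n) : ℝ :=
  pY (fun q => Xs q i) j p + ∑ r, Xs p r * K.C p i r j

/-- `X^{(i)}_{/1} := δX^{(i)}/δt + Σ_r X^{(r)} Gv^i_r`. -/
def covTv (M : E n → Fin n → ℝ) (K : Conn n) (Xv : E n → Fin n → ℝ) (i : Fin n)
    (p : E n) : ℝ :=
  dT M (fun q => Xv q i) p + ∑ r, Xv p r * K.Gv p i r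

/-- `X^{(i)}_{|j} := δX^{(i)}/δx^j + Σ_r X^{(r)} Lv^i_{rj}`. -/
def covXv (N : E n → Fin n → Fin n → ℝ) (K : Conn n) (Xv : E n → Fin n → ℝ) (i j : Fin n)
    (p : E n) : ℝ :=
  dX N (fun q => Xv q i) j p + ∑ r, Xv p r * K.Lv p i r j

/-- `X^{(i)}|_{(j)} := ∂X^{(i)}/∂y^j + Σ_r X^{(r)} Cv^i_{rj}`. -/
def covYv (K : Conn n) (Xv : E n → Fin n → ℝ) (i j : Fin n) (p : E n) : ℝ :=
  pY (fun q => Xv q i) j p + ∑ r, Xv p r * K.Cv p i r j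

/-- The d-tensor `R^r_{1k} := δM^r/δx^k − δN^r_k/δt`. -/
def Rtime (M : E n → Fin n → ℝ) (N : E n → Fin n → Fin n → ℝ) (r k : Fin n) (p : E n) : ℝ :=
  dX N (fun q => M q r) k p - dT M (fun q => N q k r) p

/-- The d-tensor `R^r_{jk} := δN^r_j/δx^k − δN^r_k/δx^j`. -/
def Rspace (N : E n → Fin n → Fin n → ℝ) (r j k : Fin n) (p : E n) : ℝ :=
  dX N (fun q => N q j r) k p - dX N (fun q => N q k r) j p

/-- Second covariant derivative `X^i_{/1|k} := δ(X^i_{/1})/δx^k + Σ_r X^r_{/1} L^i_{rk}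
− X^i_{/1} L̄_k`. -/
def covTxX (M : E n → Fin n → ℝ) (N : E n → Fin n → Fin n → ℝ) (K : Conn n)
    (Xs : E n → Fin n → ℝ) (i k : Fin n) (p : E n) : ℝ :=
  dX N (fun q => covTx M K Xs i q) k p + (∑ r, covTx M K Xs r p * K.L p i r k)
    - covTx M K Xs i p * K.Lbar p k

/-- Second covariant derivative `X^i_{|k/1} := δ(X^i_{|k})/δt + Σ_r X^r_{|k} G^i_r
− Σ_r X^i_{|r} G^r_k`. -/
def covXxT (M : E n → Fin n → ℝ) (N : E n → Fin n → Fin n → ℝ) (K : Conn n)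
    (Xs : E n → Fin n → ℝ) (i k : Fin n) (p : E n) : ℝ :=
  dT M (fun q => covXx N K Xs i k q) p + (∑ r, covXx N K Xs r k p * K.G p i r)
    - ∑ r, covXx N K Xs i r p * K.G p r k

/-- The curvature d-tensor `R^i_{r1k} := δG^i_r/δx^k − δL^i_{rk}/δt
+ Σ_s (G^s_r L^i_{sk} − L^s_{rk} G^i_s) + Σ_s C^i_{rs} R^s_{1k}`. -/
def Rmix (M : E n → Fin n → ℝ) (N : E n → Fin n → Fin n → ℝ) (K : Conn n)
    (i r k : Fin n) (p : E n) : ℝ :=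
  dX N (fun q => K.G q i r) k p - dT M (fun q => K.L q i r k) p
    + (∑ s, (K.G p s r * K.L p i s k - K.L p s r k * K.G p i s))
    + ∑ s, K.C p i r s * Rtime M N s k p

/-- The vertical part of a derivative, expanded in the frame `∂/∂y^j`. -/
lemma fderiv_vertical_apply_s15 (f : E n → ℝ) (p : E n) (v : Fin n → ℝ) :
    fderiv ℝ f p (0, 0, v) = ∑ j, v j * pY f j p := by
  have hv : ((0, 0, v) : E n) = ∑ j, v j • ((0, 0, Pi.single j 1) : E n) := by
    refine Prod.ext (by simp [Prod.fst_sum]) (Prod.ext ?_ ?_)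
    · simp [Prod.fst_sum, Prod.snd_sum]
    · simpa [Prod.snd_sum] using pi_eq_sum_univ' v
  rw [hv, map_sum]
  simp only [map_smul, smul_eq_mul, pY]

lemma dT_eq_fderiv_delT (M : E n → Fin n → ℝ) (f : E n → ℝ) (p : E n) :
    dT M f p = fderiv ℝ f p (delT M p) := by
  have h : delT M p = (1, 0, 0) + (0, 0, fun j => -(M p j)) := by simp [delT]
  rw [h, map_add, fderiv_vertical_apply_s15]
  simp [dT, pT, sub_eq_add_neg]

lemma dX_eq_fderiv_delX (N : E n → Fin n → Fin n → ℝ) (f : E n → ℝ) (i : Fin n) (p : E n) :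
    dX N f i p = fderiv ℝ f p (delX N i p) := by
  have h : delX N i p = (0, Pi.single i 1, 0) + (0, 0, fun j => -(N p i j)) := by simp [delX]
  rw [h, map_add, fderiv_vertical_apply_s15]
  simp [dX, pX, sub_eq_add_neg]

/-- The derivative of a field with constant horizontal part `(a, b)` is vertical. -/
lemma hasFDerivAt_neg_vertical (a : ℝ) (b : Fin n → ℝ) {V : E n → Fin n → ℝ} {p : E n}
    (hV : DifferentiableAt ℝ V p) :
    HasFDerivAt (fun q => ((a, b, fun j => -(V q j)) : E n))
      ((0 : E n →L[ℝ] ℝ).prod ((0 : E n →L[ℝ] (Fin n → ℝ)).prod (-fderiv ℝ V p))) p :=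
  (hasFDerivAt_const a p).prodMk ((hasFDerivAt_const b p).prodMk hV.hasFDerivAt.neg)

/-- Differentiating `q ↦ Df(q)(a, b, -V(q))` in the direction `w`. -/
lemma fderiv_fderiv_apply_neg_vertical {f : E n → ℝ} {V : E n → Fin n → ℝ}
    (hf : ContDiff ℝ (⊤ : ℕ∞) f) (hV : ContDiff ℝ (⊤ : ℕ∞) V) (a : ℝ) (b : Fin n → ℝ)
    (p w : E n) :
    fderiv ℝ (fun q => fderiv ℝ f q (a, b, fun j => -(V q j))) p w =
      fderiv ℝ (fderiv ℝ f) p w (a, b, fun j => -(V p j))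
        - ∑ j, fderiv ℝ (fun q => V q j) p w * pY f j p := by
  have hdV : DifferentiableAt ℝ V p := hV.differentiable (by simp) p
  have hdf : DifferentiableAt ℝ (fderiv ℝ f) p :=
    (hf.fderiv_right (m := (⊤ : ℕ∞)) (by simp)).differentiable (by simp) p
  have hW := hasFDerivAt_neg_vertical a b hdV
  rw [(hdf.hasFDerivAt.clm_apply hW).fderiv]
  have h := fderiv_vertical_apply_s15 f p (-(fderiv ℝ V p w))
  have hc : ∀ j, fderiv ℝ (fun q => V q j) p w = fderiv ℝ V p w j := fun j => by
    rw [fderiv_apply hdV]; rfl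
  simp only [Pi.neg_apply, neg_mul, Finset.sum_neg_distrib] at h
  simp [h, hc]
  ring

lemma ContDiff.dT {M : E n → Fin n → ℝ} {f : E n → ℝ} (hM : ContDiff ℝ (⊤ : ℕ∞) M)
    (hf : ContDiff ℝ (⊤ : ℕ∞) f) : ContDiff ℝ (⊤ : ℕ∞) (_root_.dT M f) := by
  have hd : ContDiff ℝ (⊤ : ℕ∞) (fderiv ℝ f) := hf.fderiv_right (by simp)
  have hV : ContDiff ℝ (⊤ : ℕ∞) (delT M) := by unfold delT; fun_prop
  rw [show _root_.dT M f = fun q => fderiv ℝ f q (delT M q) from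
    funext (dT_eq_fderiv_delT M f)]
  exact hd.clm_apply hV

lemma ContDiff.dX {N : E n → Fin n → Fin n → ℝ} {f : E n → ℝ} (hN : ContDiff ℝ (⊤ : ℕ∞) N)
    (hf : ContDiff ℝ (⊤ : ℕ∞) f) (i : Fin n) :
    ContDiff ℝ (⊤ : ℕ∞) (_root_.dX N f i) := by
  have hd : ContDiff ℝ (⊤ : ℕ∞) (fderiv ℝ f) := hf.fderiv_right (by simp)
  have hV : ContDiff ℝ (⊤ : ℕ∞) (delX N i) := by unfold delX; fun_prop
  rw [show _root_.dX N f i = fun q => fderiv ℝ f q (delX N i q) from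
    funext (dX_eq_fderiv_delX N f i)]
  exact hd.clm_apply hV

/-- The commutator of the adapted frame fields: `[δ/δx^k, δ/δt] = -Σ_r R^r_{1k} ∂/∂y^r`. -/
lemma dX_dT_sub_dT_dX {M : E n → Fin n → ℝ} {N : E n → Fin n → Fin n → ℝ} {f : E n → ℝ}
    (hM : ContDiff ℝ (⊤ : ℕ∞) M) (hN : ContDiff ℝ (⊤ : ℕ∞) N) (hf : ContDiff ℝ (⊤ : ℕ∞) f)
    (k : Fin n) (p : E n) :
    dX N (dT M f) k p - dT M (dX N f k) p = -∑ r, pY f r p * Rtime M N r k p := by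
  have hNk : ContDiff ℝ (⊤ : ℕ∞) (fun q => N q k) := by fun_prop
  have hsymm := (hf.contDiffAt (x := p)).isSymmSndFDerivAt
    (by
      rw [minSmoothness_of_isRCLikeNormedField]
      exact WithTop.coe_le_coe.2 (le_top (a := (2 : ℕ∞))))
    (delX N k p) (delT M p)
  have hT := fderiv_fderiv_apply_neg_vertical hf hM 1 0 p (delX N k p)
  have hX := fderiv_fderiv_apply_neg_vertical hf hNk 0 (Pi.single k 1) p (delT M p)
  rw [show dT M f = fun q => fderiv ℝ f q (delT M q) from funext (dT_eq_fderiv_delT M f),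
    show dX N f k = fun q => fderiv ℝ f q (delX N k q) from funext (dX_eq_fderiv_delX N f k),
    dX_eq_fderiv_delX, dT_eq_fderiv_delT]
  simp only [Rtime, dX_eq_fderiv_delX, dT_eq_fderiv_delT, mul_sub, Finset.sum_sub_distrib]
  simp only [← delT.eq_1, ← delX.eq_1] at hT hX
  rw [hT, hX, hsymm]
  simp only [mul_comm (pY f _ p)]
  ring

lemma fderiv_add_sum_mul_apply {F : E n → ℝ} {A B : Fin n → E n → ℝ} {p : E n}
    (hF : DifferentiableAt ℝ F p) (hA : ∀ r, DifferentiableAt ℝ (A r) p)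
    (hB : ∀ r, DifferentiableAt ℝ (B r) p) (w : E n) :
    fderiv ℝ (fun q => F q + ∑ r, A r q * B r q) p w =
      fderiv ℝ F p w + ∑ r, (fderiv ℝ (A r) p w * B r p + A r p * fderiv ℝ (B r) p w) := by
  have h := hF.hasFDerivAt.fun_add
    (HasFDerivAt.fun_sum (u := Finset.univ)
      fun r _ => (hA r).hasFDerivAt.fun_mul (hB r).hasFDerivAt)
  rw [h.fderiv]
  simp only [add_apply, sum_apply, smul_apply, smul_eq_mul]
  congr 1
  exact Finset.sum_congr rfl fun r _ => by ring

/-- Ricci identity, M-horizontal components, mixed temporal–spatial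
derivatives:
`X^i_{/1|k} − X^i_{|k/1} = Σ_r X^r R^i_{r1k} − X^i_{/1} T̄_k − Σ_r X^i_{|r} T^r_{1k}
− Σ_r X^i|_{(r)} R^r_{1k}`, where `T̄_k := L̄_k` and `T^r_{1k} := −G^r_k`. -/
theorem ricci_hM_time_space (n : ℕ) (M : E n → Fin n → ℝ) (N : E n → Fin n → Fin n → ℝ)
    (hM : ContDiff ℝ (⊤ : ℕ∞) M) (hN : ContDiff ℝ (⊤ : ℕ∞) N) (K : Conn n) (hK : K.Smooth)
    (X1 : E n → ℝ) (Xs Xv : E n → Fin n → ℝ)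
    (hX1 : ContDiff ℝ (⊤ : ℕ∞) X1) (hXs : ContDiff ℝ (⊤ : ℕ∞) Xs) (hXv : ContDiff ℝ (⊤ : ℕ∞) Xv)
    (i k : Fin n) (p : E n) :
    covTxX M N K Xs i k p - covXxT M N K Xs i k p =
      (∑ r, Xs p r * Rmix M N K i r k p) - covTx M K Xs i p * K.Lbar p k
        - (∑ r, covXx N K Xs i r p * (-(K.G p r k)))
        - ∑ r, covYx K Xs i r p * Rtime M N r k p := by
  obtain ⟨-, hG, -, -, hL, -⟩ := hK
  have hXi : ∀ r, ContDiff ℝ (⊤ : ℕ∞) (fun q => Xs q r) := fun r => by fun_prop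
  have hXd : ∀ r, DifferentiableAt ℝ (fun q => Xs q r) p := fun r =>
    (hXi r).differentiable (by simp) p
  have hGd : ∀ r, DifferentiableAt ℝ (fun q => K.G q i r) p := fun r =>
    (show ContDiff ℝ (⊤ : ℕ∞) (fun q => K.G q i r) by fun_prop).differentiable (by simp) p
  have hLd : ∀ r, DifferentiableAt ℝ (fun q => K.L q i r k) p := fun r =>
    (show ContDiff ℝ (⊤ : ℕ∞) (fun q => K.L q i r k) by fun_prop).differentiable (by simp) p
  have hT : dX N (covTx M K Xs i) k p = dX N (dT M fun q => Xs q i) k p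
      + ∑ r, (dX N (fun q => Xs q r) k p * K.G p i r
        + Xs p r * dX N (fun q => K.G q i r) k p) := by
    simp only [dX_eq_fderiv_delX]
    exact fderiv_add_sum_mul_apply ((hM.dT (hXi i)).differentiable (by simp) p) hXd hGd _
  have hX : dT M (covXx N K Xs i k) p = dT M (dX N (fun q => Xs q i) k) p
      + ∑ r, (dT M (fun q => Xs q r) p * K.L p i r k
        + Xs p r * dT M (fun q => K.L q i r k) p) := by
    simp only [dT_eq_fderiv_delT]
    exact fderiv_add_sum_mul_apply ((hN.dX (hXi i) k).differentiable (by simp) p) hXd hLd _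
  have hcomm := dX_dT_sub_dT_dX hM hN (hXi i) k p
  have hGL : ∑ r, (∑ s, Xs p s * K.G p r s) * K.L p i r k
      = ∑ r, Xs p r * ∑ s, K.G p s r * K.L p i s k := by
    simp only [Finset.sum_mul, Finset.mul_sum, mul_assoc]
    exact Finset.sum_comm
  have hLG : ∑ r, (∑ s, Xs p s * K.L p r s k) * K.G p i r
      = ∑ r, Xs p r * ∑ s, K.L p s r k * K.G p i s := by
    simp only [Finset.sum_mul, Finset.mul_sum, mul_assoc]
    exact Finset.sum_comm
  have hC : ∑ r, (∑ s, Xs p s * K.C p i s r) * Rtime M N r k p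
      = ∑ r, Xs p r * ∑ s, K.C p i r s * Rtime M N s k p := by
    simp only [Finset.sum_mul, Finset.mul_sum, mul_assoc]
    exact Finset.sum_comm
  have hcovT : ∑ r, covTx M K Xs r p * K.L p i r k = ∑ r, dT M (fun q => Xs q r) p * K.L p i r k
      + ∑ r, Xs p r * ∑ s, K.G p s r * K.L p i s k := by
    simp only [covTx, add_mul, Finset.sum_add_distrib, hGL]
  have hcovX : ∑ r, covXx N K Xs r k p * K.G p i r = ∑ r, dX N (fun q => Xs q r) k p * K.G p i r
      + ∑ r, Xs p r * ∑ s, K.L p s r k * K.G p i s := by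
    simp only [covXx, add_mul, Finset.sum_add_distrib, hLG]
  have hcovY : ∑ r, covYx K Xs i r p * Rtime M N r k p
      = ∑ r, pY (fun q => Xs q i) r p * Rtime M N r k p
      + ∑ r, Xs p r * ∑ s, K.C p i r s * Rtime M N s k p := by
    simp only [covYx, add_mul, Finset.sum_add_distrib, hC]
  rw [covTxX, covXxT, hT, hX, hcovT, hcovX, hcovY]
  simp only [Rmix, mul_add, mul_sub, mul_neg, Finset.sum_add_distrib, Finset.sum_sub_distrib,
    Finset.sum_neg_distrib]
  linarith
end
end
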